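/- Every simple G-equivariant C-algebra A is isomorphic, as a G-equivariant C-algebra, to Fun_H(G, B) for some subgroup H ≤ G, some simple C-algebra B, and some homomorphism φ : H → Aut(B). Moreover H is determined by A uniquely up to conjugation in G. -/

import Mathlib

/-- Data of a linear operad: spaces of `n`-ary operations, an identity operation,
and partial compositions. -/
structure LinearOperadData (F : Type) [Field F] where
  C : ℕ → Type
  one : C 1
  comp : ∀ {m n : ℕ}, C m → C n → Fin m → C (m + n - 1)

/-- An algebra over (the data of) a linear operad: structure maps
`α n : C n → MultilinearMap`, compatible with identity and composition. -/
structure OperadAlgebraOn (F : Type) [Field F] (O : LinearOperadData F)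
    (A : Type) [AddCommGroup A] [Module F A] where
  α : ∀ n, O.C n → MultilinearMap F (fun _ : Fin n => A) A
  α_one : ∀ a : A, α 1 O.one (fun _ => a) = a
  α_comp : ∀ {m n : ℕ} (c : O.C m) (d : O.C n) (i : Fin m) (v : Fin (m + n - 1) → A),
    α (m + n - 1) (O.comp c d i) v =
      α m c (fun k =>
        if hk : (k : ℕ) < (i : ℕ) then v ⟨k, by have := k.isLt; have := i.isLt; omega⟩
        else if hk2 : (k : ℕ) = (i : ℕ) then
          α n d (fun j => v ⟨(i : ℕ) + (j : ℕ), by have := j.isLt; have := i.isLt; omega⟩)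
        else v ⟨(k : ℕ) + n - 1, by have := k.isLt; have := i.isLt; omega⟩)

variable {F : Type} [Field F] {O : LinearOperadData F}
variable {A : Type} [AddCommGroup A] [Module F A]

/-- The partial multiplication operator `a ↦ α n c (v_1,...,a at slot j,...,v_{n-1})`. -/
def OperadAlgebraOn.op (OA : OperadAlgebraOn F O A) {n : ℕ} (c : O.C n)
    (v : Fin n → A) (j : Fin n) : Module.End F A :=
  (OA.α n c).toLinearMap v j

/-- `E_A`: the span of the partial multiplication operators with `n ≥ 2` inputs. -/
def EA (OA : OperadAlgebraOn F O A) : Submodule F (Module.End F A) :=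
  Submodule.span F
    {T | ∃ n : ℕ, 2 ≤ n ∧ ∃ (c : O.C n) (v : Fin n → A) (j : Fin n), T = OA.op c v j}

/-- `L_A`: the image of `C(1)` in `End_F(A)`. -/
def LA (OA : OperadAlgebraOn F O A) : Submodule F (Module.End F A) :=
  Submodule.span F {T | ∃ c : O.C 1, T = OA.op c (fun _ => (0 : A)) 0}

/-- `R_A = L_A + E_A`. -/
def RA (OA : OperadAlgebraOn F O A) : Submodule F (Module.End F A) :=
  LA OA ⊔ EA OA

/-- A subspace `I ⊆ A` is an ideal: closed under all operadic operations whenever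
at least one argument lies in `I`. -/
def IsIdealPred (OA : OperadAlgebraOn F O A) (I : Submodule F A) : Prop :=
  ∀ (n : ℕ) (c : O.C n) (v : Fin n → A) (j : Fin n), v j ∈ I → OA.α n c v ∈ I

/-- A relative ideal `J` of the subalgebra `P ⊆ A`. -/
def IsIdealIn (OA : OperadAlgebraOn F O A) (P J : Submodule F A) : Prop :=
  J ≤ P ∧ ∀ (n : ℕ) (c : O.C n) (v : Fin n → A) (j : Fin n),
    (∀ k, v k ∈ P) → v j ∈ J → OA.α n c v ∈ J

/-- The multiplications (with `n ≥ 2`) of `A` do not all vanish on the subspace `P`. -/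
def HasNonzeroMul (OA : OperadAlgebraOn F O A) (P : Submodule F A) : Prop :=
  ∃ n : ℕ, 2 ≤ n ∧ ∃ (c : O.C n) (v : Fin n → A), (∀ k, v k ∈ P) ∧ OA.α n c v ≠ 0

/-- `P` is a simple summand: an ideal of `A`, with no nontrivial subideals,
on which the multiplication is nonzero. -/
def IsSimplePiece (OA : OperadAlgebraOn F O A) (P : Submodule F A) : Prop :=
  IsIdealPred OA P ∧ (∀ J ≤ P, IsIdealPred OA J → J = ⊥ ∨ J = P) ∧ HasNonzeroMul OA P

/-- `A` is a simple `C`-algebra: the only ideals are `0` and `A`, and `E_A ≠ 0`. -/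
def IsSimpleAlg (OA : OperadAlgebraOn F O A) : Prop :=
  (∀ I : Submodule F A, IsIdealPred OA I → I = ⊥ ∨ I = ⊤) ∧ EA OA ≠ ⊥

/-- `A` is a semisimple `C`-algebra: a finite direct sum of simple `C`-algebras. -/
def IsSemisimpleAlg (OA : OperadAlgebraOn F O A) : Prop :=
  ∃ (m : ℕ) (P : Fin m → Submodule F A),
    iSupIndep P ∧ (⨆ i, P i) = ⊤ ∧ ∀ i, IsSimplePiece OA (P i)

/-- The group of `C`-algebra automorphisms of `A`, as a subgroup of `A ≃ₗ[F] A`. -/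
def AlgAutGroup (OA : OperadAlgebraOn F O A) : Subgroup (A ≃ₗ[F] A) where
  carrier := {f | ∀ (n : ℕ) (c : O.C n) (v : Fin n → A),
    f (OA.α n c v) = OA.α n c (fun k => f (v k))}
  one_mem' := by intro n c v; rfl
  mul_mem' := by
    intro f g hf hg n c v
    show f (g (OA.α n c v)) = _
    rw [hg, hf]
    rfl
  inv_mem' := by
    intro f hf n c v
    have h1 : ∀ x : A, f (f⁻¹ x) = x := fun x => f.apply_symm_apply x
    apply f.injective
    rw [h1, hf]
    simp only [h1]

/-- A maximal (proper) ideal of `A`. -/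
def IsMaxIdeal (OA : OperadAlgebraOn F O A) (M : Submodule F A) : Prop :=
  IsIdealPred OA M ∧ M ≠ ⊤ ∧ ∀ J, IsIdealPred OA J → M < J → J = ⊤

/-- The kernel of the projection to the maximal semisimple quotient of `A`
as an `R_A`-module (the intersection of the maximal ideals). -/
def preRad (OA : OperadAlgebraOn F O A) : Submodule F A :=
  sInf {M | IsMaxIdeal OA M}

/-- The radical of the `C`-algebra `A`: the kernel of `A → Ā`, where `Ā` is the quotient of
the maximal semisimple `R_A`-module quotient `A' = A / preRad` by the kernel of the
`E_A`-action. -/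
def radAlg (OA : OperadAlgebraOn F O A) : Submodule F A :=
  ⨅ (e : Module.End F A) (_ : e ∈ EA OA), (preRad OA).comap e

/-- An operad algebra structure on `A ⧸ I` compatible with the projection. -/
def IsQuotientAlg (OA : OperadAlgebraOn F O A) (I : Submodule F A)
    (OQ : OperadAlgebraOn F O (A ⧸ I)) : Prop :=
  ∀ (n : ℕ) (c : O.C n) (v : Fin n → A),
    I.mkQ (OA.α n c v) = OQ.α n c (fun k => I.mkQ (v k))

/-- A componentwise ("pointwise") operad algebra structure on a product. -/
def IsComponentwiseAlg {ι : Type} {B : ι → Type} [∀ i, AddCommGroup (B i)]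
    [∀ i, Module F (B i)] (OB : ∀ i, OperadAlgebraOn F O (B i))
    (OP : OperadAlgebraOn F O (∀ i, B i)) : Prop :=
  ∀ (n : ℕ) (c : O.C n) (v : Fin n → ∀ i, B i) (i : ι),
    OP.α n c v i = (OB i).α n c (fun k => v k i)

/-- Pointwise algebra structure on `ι → B`. -/
def IsPointwiseAlg {ι B : Type} [AddCommGroup B] [Module F B]
    (OB : OperadAlgebraOn F O B) (OP : OperadAlgebraOn F O (ι → B)) : Prop :=
  ∀ (n : ℕ) (c : O.C n) (v : Fin n → ι → B) (i : ι),
    OP.α n c v i = OB.α n c (fun k => v k i)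

/-- Block-diagonal inclusion `End(B i) → End(Π j, B j)`. -/
def blkMap {ι : Type} [DecidableEq ι] (B : ι → Type) [∀ i, AddCommGroup (B i)]
    [∀ i, Module F (B i)] (i : ι) :
    Module.End F (B i) →ₗ[F] Module.End F (∀ j, B j) where
  toFun T := (LinearMap.single F B i) ∘ₗ T ∘ₗ (LinearMap.proj i)
  map_add' := by
    intro T S
    ext v j
    simp [Pi.single_add]
  map_smul' := by
    intro t T
    ext v j
    simp [Pi.single_smul]

/-- The action of `Perm ι` on `ι → K` by permuting coordinates. -/
def permAct (ι K : Type) [Group K] : Equiv.Perm ι →* MulAut (ι → K) where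
  toFun σ :=
    { toFun := fun f => f ∘ σ.symm
      invFun := fun f => f ∘ σ
      left_inv := fun f => by funext x; simp
      right_inv := fun f => by funext x; simp
      map_mul' := fun f g => rfl }
  map_one' := by
    ext f x
    rfl
  map_mul' := by
    intro σ τ
    ext f x
    rfl

/-- Right translation action of `G` on `G → B`. -/
def rightTrans (G B : Type) [Group G] (g : G) : (G → B) → (G → B) :=
  fun f x => f (x * g)

/-- The space `Fun_H(G, B)` of `H`-equivariant functions `G → B`. -/
def FunHsub (G : Type) [Group G] (B : Type) [AddCommGroup B] [Module F B]
    (H : Subgroup G) (OB : OperadAlgebraOn F O B) (φ : H →* AlgAutGroup OB) :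
    Submodule F (G → B) where
  carrier := {f | ∀ (h : H) (x : G),
    f ((h : G) * x) = ((φ h : AlgAutGroup OB) : B ≃ₗ[F] B) (f x)}
  add_mem' := by
    intro f g hf hg h x
    simp [hf h x, hg h x]
  zero_mem' := by intro h x; simp
  smul_mem' := by
    intro t f hf h x
    simp [hf h x]

/-- A bundled `C`-algebra (used for existential quantification over algebras). -/
structure OperadAlgBundle (F : Type) [Field F] (O : LinearOperadData F) where
  carrier : Type
  [acg : AddCommGroup carrier]
  [mod : Module F carrier]
  alg : OperadAlgebraOn F O carrier

attribute [instance] OperadAlgBundle.acg OperadAlgBundle.mod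

/-- `(A, ρ)` is modeled by `Fun_H(G, B)` for the pair `(H, φ)`:
there is an injective `G`-equivariant `C`-algebra map of `A` onto the subalgebra
`Fun_H(G, B)` of the pointwise algebra `G → B`, where `B` is simple and `G` acts by
right translation. -/
def IsFunHModel {G : Type} [Group G] (OA : OperadAlgebraOn F O A)
    (ρ : G →* (A ≃ₗ[F] A)) (H : Subgroup G) (Bb : OperadAlgBundle F O)
    (φ : H →* AlgAutGroup Bb.alg) : Prop :=
  IsSimpleAlg Bb.alg ∧
  ∃ OGB : OperadAlgebraOn F O (G → Bb.carrier),
    IsPointwiseAlg Bb.alg OGB ∧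
    ∃ e : A →ₗ[F] (G → Bb.carrier), Function.Injective e ∧
      LinearMap.range e = FunHsub G Bb.carrier H Bb.alg φ ∧
      (∀ (n : ℕ) (c : O.C n) (v : Fin n → A),
        e (OA.α n c v) = OGB.α n c fun k => e (v k)) ∧
      (∀ (g : G) (a : A) (x : G), e (ρ g a) x = e a (x * g))

namespace OperadAlgebraOn

open Function

lemma op_apply (OA : OperadAlgebraOn F O A) {n : ℕ} (c : O.C n) (v : Fin n → A) (j : Fin n)
    (x : A) : OA.op c v j x = OA.α n c (update v j x) := rfl

lemma op_apply_self (OA : OperadAlgebraOn F O A) {n : ℕ} (c : O.C n) (v : Fin n → A)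
    (j : Fin n) : OA.op c v j (v j) = OA.α n c v := by
  rw [op_apply, update_eq_self]

/-- The span of all products with at least two factors. -/
def products (OA : OperadAlgebraOn F O A) : Submodule F A :=
  Submodule.span F {x | ∃ n : ℕ, 2 ≤ n ∧ ∃ (c : O.C n) (v : Fin n → A), x = OA.α n c v}

lemma mem_products (OA : OperadAlgebraOn F O A) {n : ℕ} (hn : 2 ≤ n) (c : O.C n)
    (v : Fin n → A) : OA.α n c v ∈ OA.products :=
  Submodule.subset_span ⟨n, hn, c, v, rfl⟩

lemma products_le (OA : OperadAlgebraOn F O A) {I : Submodule F A} :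
    OA.products ≤ I ↔ ∀ n : ℕ, 2 ≤ n → ∀ (c : O.C n) (v : Fin n → A), OA.α n c v ∈ I := by
  refine ⟨fun h n hn c v => h (OA.mem_products hn c v), fun h => Submodule.span_le.2 ?_⟩
  rintro _ ⟨n, hn, c, v, rfl⟩
  exact h n hn c v

lemma EA_eq_bot_iff (OA : OperadAlgebraOn F O A) :
    EA OA = ⊥ ↔ ∀ n : ℕ, 2 ≤ n → ∀ (c : O.C n) (v : Fin n → A), OA.α n c v = 0 := by
  constructor
  · intro h n hn c v
    have hop : OA.op c v ⟨0, by omega⟩ ∈ EA OA := Submodule.subset_span ⟨n, hn, c, v, _, rfl⟩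
    rw [h, Submodule.mem_bot] at hop
    rw [← OA.op_apply_self c v ⟨0, by omega⟩, hop, LinearMap.zero_apply]
  · intro h
    refine (Submodule.span_eq_bot).2 ?_
    rintro _ ⟨n, hn, c, v, j, rfl⟩
    ext x
    rw [op_apply, h n hn, LinearMap.zero_apply]

lemma isIdealPred_iff_le_comap_op (OA : OperadAlgebraOn F O A) {I : Submodule F A} :
    IsIdealPred OA I ↔
      ∀ (n : ℕ) (c : O.C n) (v : Fin n → A) (j : Fin n), I ≤ I.comap (OA.op c v j) := by
  constructor
  · intro h n c v j x hx
    exact h n c _ j (by simpa using hx)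
  · intro h n c v j hj
    rw [← OA.op_apply_self c v j]
    exact h n c v j hj

lemma isIdealPred_sup (OA : OperadAlgebraOn F O A) {I J : Submodule F A}
    (hI : IsIdealPred OA I) (hJ : IsIdealPred OA J) : IsIdealPred OA (I ⊔ J) := by
  rw [isIdealPred_iff_le_comap_op] at *
  intro n c v j
  exact sup_le ((hI n c v j).trans (Submodule.comap_mono le_sup_left))
    ((hJ n c v j).trans (Submodule.comap_mono le_sup_right))

lemma isIdealPred_inf (OA : OperadAlgebraOn F O A) {I J : Submodule F A}
    (hI : IsIdealPred OA I) (hJ : IsIdealPred OA J) : IsIdealPred OA (I ⊓ J) :=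
  fun n c v j hj => ⟨hI n c v j hj.1, hJ n c v j hj.2⟩

lemma isIdealPred_iInf (OA : OperadAlgebraOn F O A) {ι : Sort*} {I : ι → Submodule F A}
    (hI : ∀ i, IsIdealPred OA (I i)) : IsIdealPred OA (⨅ i, I i) := by
  intro n c v j hj
  rw [Submodule.mem_iInf] at *
  exact fun i => hI i n c v j (hj i)

lemma isIdealPred_top (OA : OperadAlgebraOn F O A) : IsIdealPred OA ⊤ :=
  fun _ _ _ _ _ => Submodule.mem_top

lemma isIdealPred_bot (OA : OperadAlgebraOn F O A) : IsIdealPred OA ⊥ :=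
  fun _ c _ j hj => (OA.α _ c).map_coord_zero j hj

lemma isIdealPred_products (OA : OperadAlgebraOn F O A) : IsIdealPred OA OA.products := by
  rw [isIdealPred_iff_le_comap_op]
  intro m c v j
  refine Submodule.span_le.2 ?_
  rintro _ ⟨n, hn, d, w, rfl⟩
  show OA.op c v j (OA.α n d w) ∈ OA.products
  rw [op_apply]
  have hm := j.isLt
  obtain hm2 | rfl : 2 ≤ m ∨ m = 1 := by omega
  · exact OA.mem_products hm2 c _
  · have key := OA.α_comp c d j (fun k => w ⟨k, by omega⟩)
    have : update v j (OA.α n d w) = fun _ => OA.α n d w := by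
      funext k
      rw [Subsingleton.elim k j, update_self]
    rw [this]
    convert OA.mem_products (by omega : 2 ≤ 1 + n - 1) (O.comp c d j) (fun k => w ⟨k, by omega⟩)
      using 1
    rw [key]
    congr 1
    funext k
    obtain rfl := Subsingleton.elim k j
    simp

/-- Changing the arguments of an operation modulo an ideal changes its value modulo that ideal. -/
lemma sub_mem_of_forall_sub_mem (OA : OperadAlgebraOn F O A) {I : Submodule F A}
    (hI : IsIdealPred OA I) {n : ℕ} (c : O.C n) {v w : Fin n → A} (h : ∀ k, v k - w k ∈ I) :
    OA.α n c v - OA.α n c w ∈ I := by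
  classical
  have key : ∀ s : Finset (Fin n), OA.α n c (s.piecewise v w) - OA.α n c w ∈ I := by
    intro s
    induction s using Finset.induction_on with
    | empty => simp
    | insert j s hj ih =>
      have h1 := hI n c (update (s.piecewise v w) j (v j - w j)) j (by simpa using h j)
      rw [MultilinearMap.map_update_sub] at h1
      have h2 : update (s.piecewise v w) j (w j) = s.piecewise v w := by
        rw [update_eq_self_iff, Finset.piecewise_eq_of_notMem _ _ _ hj]
      rw [h2, ← Finset.piecewise_insert] at h1
      simpa using I.add_mem h1 ih
  simpa using key Finset.univ

/-- If the quotient by `M` is spanned by products, then ideals comaximal with `M` have an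
intersection comaximal with `M`. -/
lemma sup_inf_eq_top (OA : OperadAlgebraOn F O A) {M J K : Submodule F A}
    (hM : IsIdealPred OA M) (hJ : IsIdealPred OA J) (hK : IsIdealPred OA K)
    (hMP : M ⊔ OA.products = ⊤) (hMJ : M ⊔ J = ⊤) (hMK : M ⊔ K = ⊤) : M ⊔ (J ⊓ K) = ⊤ := by
  rw [eq_top_iff, ← hMP]
  refine sup_le le_sup_left (OA.products_le.2 fun n hn c v => ?_)
  let i₀ : Fin n := ⟨0, by omega⟩
  let i₁ : Fin n := ⟨1, by omega⟩
  have hne : i₀ ≠ i₁ := by simp [i₀, i₁]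
  obtain ⟨p, hp, y, hy, hpy⟩ := Submodule.mem_sup.1 (hMJ ▸ Submodule.mem_top : v i₀ ∈ M ⊔ J)
  obtain ⟨q, hq, z, hz, hqz⟩ := Submodule.mem_sup.1 (hMK ▸ Submodule.mem_top : v i₁ ∈ M ⊔ K)
  let w : Fin n → A := update (update v i₀ y) i₁ z
  have hw₀ : w i₀ = y := by simp [w, hne]
  have hw₁ : w i₁ = z := by simp [w]
  have hvw : ∀ k, v k - w k ∈ M := by
    intro k
    by_cases h₁ : k = i₁
    · rw [h₁, hw₁, ← hqz]; simpa using hq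
    by_cases h₀ : k = i₀
    · rw [h₀, hw₀, ← hpy]; simpa using hp
    simp [w, h₁, h₀]
  exact Submodule.mem_sup.2 ⟨_, OA.sub_mem_of_forall_sub_mem hM c hvw, OA.α n c w,
    ⟨hJ n c w i₀ (hw₀ ▸ hy), hK n c w i₁ (hw₁ ▸ hz)⟩, sub_add_cancel _ _⟩

lemma isIdealPred_finset_inf (OA : OperadAlgebraOn F O A) {s : Finset (Submodule F A)}
    (hs : ∀ K ∈ s, IsIdealPred OA K) : IsIdealPred OA (s.inf id) := by
  classical
  induction s using Finset.induction_on with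
  | empty => exact OA.isIdealPred_top
  | insert K s _ ih =>
    rw [Finset.inf_insert]
    exact OA.isIdealPred_inf (hs K (Finset.mem_insert_self _ _))
      (ih fun J hJ => hs J (Finset.mem_insert_of_mem hJ))

lemma sup_finset_inf_eq_top (OA : OperadAlgebraOn F O A) {M : Submodule F A}
    (hM : IsIdealPred OA M) (hMP : M ⊔ OA.products = ⊤) {s : Finset (Submodule F A)}
    (hs : ∀ K ∈ s, IsIdealPred OA K) (hMs : ∀ K ∈ s, M ⊔ K = ⊤) : M ⊔ s.inf id = ⊤ := by
  classical
  induction s using Finset.induction_on with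
  | empty => simp
  | insert K s _ ih =>
    have hs' : ∀ J ∈ s, IsIdealPred OA J := fun J hJ => hs J (Finset.mem_insert_of_mem hJ)
    rw [Finset.inf_insert]
    exact OA.sup_inf_eq_top hM (hs K (Finset.mem_insert_self _ _))
      (OA.isIdealPred_finset_inf hs') hMP (hMs K (Finset.mem_insert_self _ _))
      (ih hs' fun J hJ => hMs J (Finset.mem_insert_of_mem hJ))

lemma sup_products_eq_top (OA : OperadAlgebraOn F O A) {M : Submodule F A}
    (hM : IsMaxIdeal OA M) (hP : ¬ OA.products ≤ M) : M ⊔ OA.products = ⊤ :=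
  hM.2.2 _ (OA.isIdealPred_sup hM.1 OA.isIdealPred_products) (left_lt_sup.2 hP)

/-- Chinese remainder theorem for maximal ideals not containing all products. -/
lemma exists_forall_sub_mem (OA : OperadAlgebraOn F O A) {s : Finset (Submodule F A)}
    (hs : ∀ M ∈ s, IsMaxIdeal OA M ∧ ¬ OA.products ≤ M) (t : Submodule F A → A) :
    ∃ a, ∀ M ∈ s, a - t M ∈ M := by
  classical
  induction s using Finset.induction_on with
  | empty => simp
  | insert M s hMs ih =>
    have hs' : ∀ J ∈ s, IsMaxIdeal OA J ∧ ¬ OA.products ≤ J :=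
      fun J hJ => hs J (Finset.mem_insert_of_mem hJ)
    obtain ⟨a, ha⟩ := ih hs'
    obtain ⟨hM, hP⟩ := hs M (Finset.mem_insert_self _ _)
    have hsup : M ⊔ s.inf id = ⊤ := by
      refine OA.sup_finset_inf_eq_top hM.1 (OA.sup_products_eq_top hM hP)
        (fun K hK => (hs' K hK).1.1) fun K hK => ?_
      refine hM.2.2 _ (OA.isIdealPred_sup hM.1 (hs' K hK).1.1) (left_lt_sup.2 fun hle => ?_)
      refine hM.2.1 ((hs' K hK).1.2.2 M hM.1 (lt_of_le_of_ne hle ?_))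
      rintro rfl
      exact hMs hK
    obtain ⟨p, hp, y, hy, hpy⟩ :=
      Submodule.mem_sup.1 (hsup ▸ Submodule.mem_top : t M - a ∈ M ⊔ s.inf id)
    refine ⟨a + y, fun K hK => ?_⟩
    obtain rfl | hK := Finset.mem_insert.1 hK
    · have : a + y - t K = -p := by
        rw [← sub_eq_iff_eq_add'.2 hpy.symm]; abel
      rw [this]
      exact K.neg_mem hp
    · have hyK : y ∈ K := (Finset.inf_le hK : s.inf id ≤ K) hy
      rw [add_sub_right_comm]
      exact K.add_mem (ha K hK) hyK

lemma exists_isMaxIdeal (OA : OperadAlgebraOn F O A) [FiniteDimensional F A] [Nontrivial A] :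
    ∃ M, IsMaxIdeal OA M := by
  obtain ⟨M, ⟨hM, hM'⟩, hmax⟩ := WellFounded.has_min (wellFounded_gt (α := Submodule F A))
    {M | IsIdealPred OA M ∧ M ≠ ⊤} ⟨⊥, OA.isIdealPred_bot, bot_ne_top⟩
  refine ⟨M, hM, hM', fun J hJ hlt => ?_⟩
  by_contra hJ'
  exact hmax J ⟨hJ, hJ'⟩ hlt

/-- The preimage of an ideal under an algebra map is an ideal. -/
lemma isIdealPred_comap {B : Type} [AddCommGroup B] [Module F B] (OA : OperadAlgebraOn F O A)
    (OB : OperadAlgebraOn F O B) {f : A →ₗ[F] B}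
    (hf : ∀ (n : ℕ) (c : O.C n) (v : Fin n → A), f (OA.α n c v) = OB.α n c fun k => f (v k))
    {I : Submodule F B} (hI : IsIdealPred OB I) : IsIdealPred OA (I.comap f) := by
  intro n c v j hj
  rw [Submodule.mem_comap, hf]
  exact hI n c _ j hj

/-- The image of an ideal under a surjective algebra map is an ideal. -/
lemma isIdealPred_map {B : Type} [AddCommGroup B] [Module F B] (OA : OperadAlgebraOn F O A)
    (OB : OperadAlgebraOn F O B) {f : A →ₗ[F] B} (hsurj : Surjective f)
    (hf : ∀ (n : ℕ) (c : O.C n) (v : Fin n → A), f (OA.α n c v) = OB.α n c fun k => f (v k))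
    {I : Submodule F A} (hI : IsIdealPred OA I) : IsIdealPred OB (I.map f) := by
  intro n c v j hj
  obtain ⟨x, hx, hxj⟩ := hj
  choose w hw using fun k => hsurj (v k)
  refine ⟨OA.α n c (update w j x), hI n c _ j (by simpa using hx), ?_⟩
  rw [hf]
  congr 1
  funext k
  by_cases h : k = j
  · subst h; simpa using hxj
  · simp [h, hw]

/-- The kernel of a surjective algebra map onto a simple algebra is a maximal ideal not
containing all products. -/
lemma isMaxIdeal_ker {B : Type} [AddCommGroup B] [Module F B] (OA : OperadAlgebraOn F O A)
    (OB : OperadAlgebraOn F O B) {f : A →ₗ[F] B} (hsurj : Surjective f)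
    (hf : ∀ (n : ℕ) (c : O.C n) (v : Fin n → A), f (OA.α n c v) = OB.α n c fun k => f (v k))
    (hB : IsSimpleAlg OB) :
    IsMaxIdeal OA (LinearMap.ker f) ∧ ¬ OA.products ≤ LinearMap.ker f := by
  have hP : ¬ OA.products ≤ LinearMap.ker f := by
    intro hle
    refine hB.2 (OB.EA_eq_bot_iff.2 fun n hn c v => ?_)
    choose w hw using fun k => hsurj (v k)
    have := OA.products_le.1 hle n hn c w
    rw [LinearMap.mem_ker, hf] at this
    simpa only [hw] using this
  refine ⟨⟨OA.isIdealPred_comap OB hf OB.isIdealPred_bot, ?_, fun J hJ hlt => ?_⟩, hP⟩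
  · intro h
    exact hP (h ▸ le_top)
  · have hcomap : (J.map f).comap f = J := by
      rw [Submodule.comap_map_eq, sup_eq_left.2 hlt.le]
    obtain h | h := hB.1 _ (OA.isIdealPred_map OB hsurj hf hJ)
    · rw [h] at hcomap
      exact absurd hcomap hlt.ne
    · rw [← hcomap, h, Submodule.comap_top]

/-- The quotient of an algebra by an ideal. -/
noncomputable def quotient (OA : OperadAlgebraOn F O A) (I : Submodule F A)
    (hI : IsIdealPred OA I) : OperadAlgebraOn F O (A ⧸ I) :=
  have hmk : ∀ {n : ℕ} (c : O.C n) (v w : Fin n → A), (∀ k, I.mkQ (v k) = I.mkQ (w k)) →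
      I.mkQ (OA.α n c v) = I.mkQ (OA.α n c w) := fun c v w h =>
    (Submodule.Quotient.eq I).2 <| OA.sub_mem_of_forall_sub_mem hI c fun k =>
      (Submodule.Quotient.eq I).1 (h k)
  have hout : ∀ x : A ⧸ I, I.mkQ (Quotient.out x) = x := fun x => Quotient.out_eq x
  have hupdate : ∀ {n : ℕ} [DecidableEq (Fin n)] (c : O.C n) (v : Fin n → A ⧸ I) (j : Fin n)
      (z : A ⧸ I) (b : A), I.mkQ b = z →
      I.mkQ (OA.α n c fun k => Quotient.out (update v j z k)) =
        I.mkQ (OA.α n c (update (fun k => Quotient.out (v k)) j b)) := by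
    intro n _ c v j z b hb
    refine hmk c _ _ fun k => ?_
    rw [hout]
    by_cases h : k = j
    · subst h; simpa using hb.symm
    · simp only [update_of_ne h, hout]
  { α := fun n c =>
      { toFun := fun v => I.mkQ (OA.α n c fun k => Quotient.out (v k))
        map_update_add' := by
          intro _ v j x y
          rw [hupdate c v j _ (Quotient.out x + Quotient.out y) (by rw [map_add, hout, hout]),
            hupdate c v j x _ (hout x), hupdate c v j y _ (hout y),
            MultilinearMap.map_update_add, map_add]
        map_update_smul' := by
          intro _ v j t x
          rw [hupdate c v j _ (t • Quotient.out x) (by rw [map_smul, hout]),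
            hupdate c v j x _ (hout x), MultilinearMap.map_update_smul, map_smul] }
    α_one := fun a => by
      show I.mkQ (OA.α 1 O.one fun _ => Quotient.out a) = a
      rw [OA.α_one, hout]
    α_comp := fun {m n} c d i v => by
      show I.mkQ (OA.α _ (O.comp c d i) fun k => Quotient.out (v k)) =
        I.mkQ (OA.α m c fun k => Quotient.out _)
      rw [OA.α_comp]
      refine hmk c _ _ fun k => ?_
      rw [hout]
      split_ifs with h₁ h₂
      · rw [hout]
      · rfl
      · rw [hout] }

lemma isQuotientAlg_quotient (OA : OperadAlgebraOn F O A) (I : Submodule F A)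
    (hI : IsIdealPred OA I) : IsQuotientAlg OA I (OA.quotient I hI) := by
  intro n c v
  refine (Submodule.Quotient.eq I).2 (OA.sub_mem_of_forall_sub_mem hI c fun k => ?_)
  exact (Submodule.Quotient.eq I).1 (Quotient.out_eq (I.mkQ (v k))).symm

/-- The pointwise algebra structure on functions with values in an algebra. -/
def pointwise (OA : OperadAlgebraOn F O A) (ι : Type) : OperadAlgebraOn F O (ι → A) where
  α n c := MultilinearMap.pi fun i => (OA.α n c).compLinearMap fun _ => LinearMap.proj i
  α_one a := funext fun i => OA.α_one (a i)
  α_comp c d i v := by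
    funext x
    refine (OA.α_comp c d i fun k => v k x).trans (congrArg (OA.α _ c) (funext fun k => ?_))
    simp only [LinearMap.proj_apply]
    split_ifs <;> rfl

lemma isSimpleAlg_quotient (OA : OperadAlgebraOn F O A) {M : Submodule F A}
    (hM : IsMaxIdeal OA M) (hP : ¬ OA.products ≤ M) :
    IsSimpleAlg (OA.quotient M hM.1) := by
  have hq := OA.isQuotientAlg_quotient M hM.1
  refine ⟨fun I hI => ?_, fun h => hP (OA.products_le.2 fun n hn c v => ?_)⟩
  · have hI' := OA.isIdealPred_comap _ hq hI
    have hmap : (I.comap M.mkQ).map M.mkQ = I :=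
      Submodule.map_comap_eq_of_surjective M.mkQ_surjective I
    have hle : M ≤ I.comap M.mkQ := M.le_comap_mkQ I
    obtain h | h := hle.eq_or_lt
    · left
      rw [← hmap, ← h, Submodule.mkQ_map_self]
    · right
      rw [← hmap, hM.2.2 _ hI' h, Submodule.map_top, Submodule.range_mkQ]
  · have := (EA_eq_bot_iff _).1 h n hn c fun k => M.mkQ (v k)
    rw [← hq] at this
    exact (Submodule.Quotient.mk_eq_zero M).1 this

lemma isMaxIdeal_comap_equiv (OA : OperadAlgebraOn F O A) {f : A ≃ₗ[F] A}
    (hf : f ∈ AlgAutGroup OA) {M : Submodule F A} (hM : IsMaxIdeal OA M) :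
    IsMaxIdeal OA (M.comap (f : A →ₗ[F] A)) := by
  refine ⟨OA.isIdealPred_comap OA hf hM.1, fun h => hM.2.1 ?_, fun J hJ hlt => ?_⟩
  · rw [← Submodule.map_comap_eq_of_surjective (f := (f : A →ₗ[F] A)) f.surjective M, h,
      Submodule.map_top, LinearMap.range_eq_top.2 f.surjective]
  · have hJ' := OA.isIdealPred_map OA (f := (f : A →ₗ[F] A)) f.surjective hf hJ
    have hback : (J.map (f : A →ₗ[F] A)).comap (f : A →ₗ[F] A) = J :=
      Submodule.comap_map_eq_of_injective f.injective J
    rw [← hback, hM.2.2 _ hJ' (lt_of_le_of_ne ?_ ?_), Submodule.comap_top]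
    · rw [← Submodule.map_comap_eq_of_surjective (f := (f : A →ₗ[F] A)) f.surjective M]
      exact Submodule.map_mono hlt.le
    · intro h
      rw [← h] at hback
      exact hlt.ne hback

end OperadAlgebraOn

section Equivariant

variable {G : Type} [Group G]

/-- The invTranslate `ρ(x)⁻¹ M` of a subspace. -/
def invTranslate (ρ : G →* (A ≃ₗ[F] A)) (M : Submodule F A) (x : G) : Submodule F A :=
  M.comap (ρ x : A →ₗ[F] A)

lemma mem_invTranslate {ρ : G →* (A ≃ₗ[F] A)} {M : Submodule F A} {x : G} {a : A} :
    a ∈ invTranslate ρ M x ↔ ρ x a ∈ M := Iff.rfl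

lemma invTranslate_mul (ρ : G →* (A ≃ₗ[F] A)) (M : Submodule F A) (x y : G) :
    invTranslate ρ M (x * y) = invTranslate ρ (invTranslate ρ M x) y := by
  ext a
  simp only [mem_invTranslate, map_mul, LinearEquiv.mul_apply]

lemma invTranslate_one (ρ : G →* (A ≃ₗ[F] A)) (M : Submodule F A) : invTranslate ρ M 1 = M := by
  ext a
  simp only [mem_invTranslate, map_one, LinearEquiv.coe_one, id_eq]

/-- The stabilizer of a subspace. -/
def translateStabilizer (ρ : G →* (A ≃ₗ[F] A)) (M : Submodule F A) : Subgroup G where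
  carrier := {x | invTranslate ρ M x = M}
  one_mem' := invTranslate_one ρ M
  mul_mem' := by
    intro x y hx hy
    show invTranslate ρ M (x * y) = M
    rw [invTranslate_mul, hx, hy]
  inv_mem' := by
    intro x hx
    show invTranslate ρ M x⁻¹ = M
    have h := invTranslate_mul ρ M x x⁻¹
    rw [mul_inv_cancel, invTranslate_one, hx] at h
    exact h.symm

lemma mem_translateStabilizer {ρ : G →* (A ≃ₗ[F] A)} {M : Submodule F A} {x : G} :
    x ∈ translateStabilizer ρ M ↔ invTranslate ρ M x = M := Iff.rfl

lemma invTranslate_eq_invTranslate_iff {ρ : G →* (A ≃ₗ[F] A)} {M : Submodule F A} {x y : G} :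
    invTranslate ρ M x = invTranslate ρ M y ↔ x * y⁻¹ ∈ translateStabilizer ρ M := by
  rw [mem_translateStabilizer, invTranslate_mul]
  constructor
  · intro h
    rw [h, ← invTranslate_mul, mul_inv_cancel, invTranslate_one]
  · intro h
    conv_rhs => rw [← h]
    rw [← invTranslate_mul, inv_mul_cancel, invTranslate_one]

lemma map_eq_of_mem_translateStabilizer {ρ : G →* (A ≃ₗ[F] A)} {M : Submodule F A} {x : G}
    (hx : x ∈ translateStabilizer ρ M) : M.map (ρ x : A →ₗ[F] A) = M := by
  conv_lhs => rw [← mem_translateStabilizer.1 hx]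
  exact Submodule.map_comap_eq_of_surjective (f := (ρ x : A →ₗ[F] A)) (ρ x).surjective M

/-- The action of the stabilizer of an ideal on the quotient algebra. -/
noncomputable def stabilizerAut (OA : OperadAlgebraOn F O A) (ρ : G →* (A ≃ₗ[F] A))
    (hρ : ∀ g, ρ g ∈ AlgAutGroup OA) (M : Submodule F A) (hM : IsIdealPred OA M) :
    translateStabilizer ρ M →* AlgAutGroup (OA.quotient M hM) where
  toFun h := ⟨Submodule.Quotient.equiv M M (ρ h) (map_eq_of_mem_translateStabilizer h.2), by
    intro n c v
    have hq := OA.isQuotientAlg_quotient M hM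
    choose w hw using fun k => M.mkQ_surjective (v k)
    obtain rfl : (fun k => M.mkQ (w k)) = v := funext hw
    rw [← hq]
    show M.mkQ (ρ h (OA.α n c w)) = (OA.quotient M hM).α n c fun k => M.mkQ (ρ h (w k))
    rw [hρ, hq]⟩
  map_one' := by
    refine Subtype.ext (LinearEquiv.ext fun x => ?_)
    obtain ⟨a, rfl⟩ := M.mkQ_surjective x
    show M.mkQ (ρ (1 : G) a) = M.mkQ a
    rw [map_one, LinearEquiv.coe_one, id_eq]
  map_mul' h k := by
    refine Subtype.ext (LinearEquiv.ext fun x => ?_)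
    obtain ⟨a, rfl⟩ := M.mkQ_surjective x
    show M.mkQ (ρ ((h : G) * k) a) = M.mkQ (ρ h (ρ k a))
    rw [map_mul, LinearEquiv.mul_apply]

lemma stabilizerAut_mkQ (OA : OperadAlgebraOn F O A) (ρ : G →* (A ≃ₗ[F] A))
    (hρ : ∀ g, ρ g ∈ AlgAutGroup OA) (M : Submodule F A) (hM : IsIdealPred OA M)
    (h : translateStabilizer ρ M) (a : A) :
    (stabilizerAut OA ρ hρ M hM h : (A ⧸ M) ≃ₗ[F] (A ⧸ M)) (M.mkQ a) = M.mkQ (ρ h a) := rfl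

lemma isMaxIdeal_invTranslate {OA : OperadAlgebraOn F O A} {ρ : G →* (A ≃ₗ[F] A)}
    (hρ : ∀ g, ρ g ∈ AlgAutGroup OA) {M : Submodule F A} (hM : IsMaxIdeal OA M) (x : G) :
    IsMaxIdeal OA (invTranslate ρ M x) :=
  OA.isMaxIdeal_comap_equiv (hρ x) hM

lemma iInf_invTranslate_eq_bot {OA : OperadAlgebraOn F O A} {ρ : G →* (A ≃ₗ[F] A)}
    (hρ : ∀ g, ρ g ∈ AlgAutGroup OA)
    (hsimple : ∀ I : Submodule F A, IsIdealPred OA I →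
      (∀ g, ∀ x ∈ I, ρ g x ∈ I) → I = ⊥ ∨ I = ⊤)
    {M : Submodule F A} (hM : IsMaxIdeal OA M) : ⨅ x, invTranslate ρ M x = ⊥ := by
  refine (hsimple _ (OA.isIdealPred_iInf fun x => (isMaxIdeal_invTranslate hρ hM x).1)
    fun g a ha => ?_).resolve_right fun h => hM.2.1 ?_
  · rw [Submodule.mem_iInf] at ha ⊢
    intro x
    have := ha (x * g)
    rwa [mem_invTranslate, map_mul, LinearEquiv.mul_apply] at this
  · rw [eq_top_iff, ← h]
    exact (iInf_le _ 1).trans (invTranslate_one ρ M).le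

lemma not_products_le_invTranslate {OA : OperadAlgebraOn F O A} {ρ : G →* (A ≃ₗ[F] A)}
    (hρ : ∀ g, ρ g ∈ AlgAutGroup OA)
    (hsimple : ∀ I : Submodule F A, IsIdealPred OA I →
      (∀ g, ∀ x ∈ I, ρ g x ∈ I) → I = ⊥ ∨ I = ⊤)
    (hE : EA OA ≠ ⊥) {M : Submodule F A} (hM : IsMaxIdeal OA M) (y : G) :
    ¬ OA.products ≤ invTranslate ρ M y := by
  intro hle
  refine hE (OA.EA_eq_bot_iff.2 fun n hn c v => ?_)
  rw [← Submodule.mem_bot F, ← iInf_invTranslate_eq_bot hρ hsimple hM, Submodule.mem_iInf]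
  intro x
  have := OA.products_le.1 hle n hn c fun k => ρ (y⁻¹ * x) (v k)
  rw [← hρ, mem_invTranslate, ← LinearEquiv.mul_apply, ← map_mul, mul_inv_cancel_left] at this
  exact this

/-- A simple equivariant algebra is modeled by functions with values in the quotient by any
maximal ideal, equivariant under the stabilizer of that ideal. -/
theorem isFunHModel_translateStabilizer [Finite G] {OA : OperadAlgebraOn F O A}
    {ρ : G →* (A ≃ₗ[F] A)} (hρ : ∀ g, ρ g ∈ AlgAutGroup OA)
    (hsimple : ∀ I : Submodule F A, IsIdealPred OA I →
      (∀ g, ∀ x ∈ I, ρ g x ∈ I) → I = ⊥ ∨ I = ⊤)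
    (hE : EA OA ≠ ⊥) {M : Submodule F A} (hM : IsMaxIdeal OA M) :
    IsFunHModel OA ρ (translateStabilizer ρ M) ⟨A ⧸ M, OA.quotient M hM.1⟩
      (stabilizerAut OA ρ hρ M hM.1) := by
  classical
  have := Fintype.ofFinite G
  have hP : ∀ y, ¬ OA.products ≤ invTranslate ρ M y :=
    not_products_le_invTranslate hρ hsimple hE hM
  have hinf := iInf_invTranslate_eq_bot hρ hsimple hM
  have hq := OA.isQuotientAlg_quotient M hM.1
  have hsmul := stabilizerAut_mkQ OA ρ hρ M hM.1
  refine ⟨OA.isSimpleAlg_quotient hM (invTranslate_one ρ M ▸ hP 1),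
    (OA.quotient M hM.1).pointwise G, fun _ _ _ _ => rfl,
    LinearMap.pi fun x => M.mkQ ∘ₗ (ρ x : A →ₗ[F] A), ?_, ?_, ?_, ?_⟩
  · refine (injective_iff_map_eq_zero _).2 fun a ha => ?_
    rw [← Submodule.mem_bot F, ← hinf, Submodule.mem_iInf]
    exact fun x => (Submodule.Quotient.mk_eq_zero M).1 (congrFun ha x)
  · refine le_antisymm ?_ fun f hf => ?_
    · rintro _ ⟨a, rfl⟩ h x
      show M.mkQ (ρ ((h : G) * x) a) = _
      rw [map_mul, LinearEquiv.mul_apply]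
      rfl
    · have hlift : ∀ N : Submodule F A, ∃ t : A, ∀ y, invTranslate ρ M y = N →
          M.mkQ (ρ y t) = f y := by
        intro N
        by_cases hN : ∃ x, invTranslate ρ M x = N
        · obtain ⟨x, rfl⟩ := hN
          obtain ⟨b, hb⟩ := M.mkQ_surjective (f x)
          obtain ⟨t, rfl⟩ := (ρ x).surjective b
          refine ⟨t, fun y hy => ?_⟩
          have h := hf ⟨_, invTranslate_eq_invTranslate_iff.1 hy⟩ x
          simp only [inv_mul_cancel_right] at h
          rw [h, ← hb]
          erw [hsmul]
          rw [← LinearEquiv.mul_apply, ← map_mul, inv_mul_cancel_right]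
        · exact ⟨0, fun y hy => absurd ⟨y, hy⟩ hN⟩
      choose t ht using hlift
      obtain ⟨a, ha⟩ := OA.exists_forall_sub_mem (s := Finset.univ.image (invTranslate ρ M))
        (by
          intro N hN
          obtain ⟨x, -, rfl⟩ := Finset.mem_image.1 hN
          exact ⟨isMaxIdeal_invTranslate hρ hM x, hP x⟩) t
      refine ⟨a, funext fun x => ?_⟩
      have hx := ha (invTranslate ρ M x) (Finset.mem_image_of_mem _ (Finset.mem_univ x))
      rw [mem_invTranslate, map_sub] at hx
      rw [← ht _ x rfl]
      exact (Submodule.Quotient.eq M).2 hx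
  · intro n c v
    funext x
    show M.mkQ (ρ x (OA.α n c v)) = (OA.quotient M hM.1).α n c fun k => M.mkQ (ρ x (v k))
    rw [hρ, hq]
  · intro g a x
    show M.mkQ (ρ x (ρ g a)) = M.mkQ (ρ (x * g) a)
    rw [map_mul, LinearEquiv.mul_apply]

/-- The subgroup of a model is the stabilizer of a maximal ideal not containing all products. -/
theorem IsFunHModel.exists_isMaxIdeal {OA : OperadAlgebraOn F O A} {ρ : G →* (A ≃ₗ[F] A)}
    {H : Subgroup G} {Bb : OperadAlgBundle F O} {φ : H →* AlgAutGroup Bb.alg}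
    (hmodel : IsFunHModel OA ρ H Bb φ) :
    ∃ M, IsMaxIdeal OA M ∧ ¬ OA.products ≤ M ∧ H = translateStabilizer ρ M := by
  classical
  obtain ⟨hB, OGB, hpt, e, -, hrange, halg, hequiv⟩ := hmodel
  have hmem : ∀ a (h : H) (x : G), e a (h * x) =
      (φ h : Bb.carrier ≃ₗ[F] Bb.carrier) (e a x) := by
    intro a
    have : e a ∈ FunHsub G Bb.carrier H Bb.alg φ := hrange ▸ LinearMap.mem_range_self e a
    exact this
  have hex : ∀ b : Bb.carrier, ∃ a, e a 1 = b ∧ ∀ x ∉ H, e a x = 0 := by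
    intro b
    let f : G → Bb.carrier := fun x =>
      if hx : x ∈ H then (φ ⟨x, hx⟩ : Bb.carrier ≃ₗ[F] Bb.carrier) b else 0
    have hf : f ∈ FunHsub G Bb.carrier H Bb.alg φ := by
      intro h x
      by_cases hx : x ∈ H
      · have hhx : (h : G) * x ∈ H := H.mul_mem h.2 hx
        have : (⟨(h : G) * x, hhx⟩ : H) = h * ⟨x, hx⟩ := rfl
        simp only [f, dif_pos hx, dif_pos hhx, this, map_mul, Subgroup.coe_mul,
          LinearEquiv.mul_apply]
      · have hhx : (h : G) * x ∉ H := fun h' => hx ((H.mul_mem_cancel_left h.2).1 h')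
        simp only [f, dif_neg hx, dif_neg hhx, map_zero]
    rw [← hrange] at hf
    obtain ⟨a, ha⟩ := hf
    refine ⟨a, ?_, fun x hx => ?_⟩
    · rw [ha]
      have h1 : (⟨1, H.one_mem⟩ : H) = 1 := rfl
      simp only [f, dif_pos H.one_mem, h1, map_one, Subgroup.coe_one, LinearEquiv.coe_one, id_eq]
    · rw [ha]
      simp only [f, dif_neg hx]
  let ev : A →ₗ[F] Bb.carrier := LinearMap.proj 1 ∘ₗ e
  have hev : ∀ a, ev a = e a 1 := fun _ => rfl
  obtain ⟨hmax, hP⟩ := OA.isMaxIdeal_ker Bb.alg (f := ev)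
    (fun b => (hex b).imp fun a ha => ha.1) (fun n c v => by
      rw [hev, halg, hpt]
      rfl) hB
  refine ⟨LinearMap.ker ev, hmax, hP, ?_⟩
  ext x
  have htr : ∀ a, a ∈ invTranslate ρ (LinearMap.ker ev) x ↔ e a x = 0 := by
    intro a
    rw [mem_invTranslate, LinearMap.mem_ker, hev, hequiv, one_mul]
  rw [mem_translateStabilizer]
  constructor
  · intro hx
    ext a
    have h := hmem a ⟨x, hx⟩ 1
    simp only [mul_one] at h
    rw [htr, h, LinearMap.mem_ker, hev, LinearEquiv.map_eq_zero_iff]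
  · intro heq
    by_contra hx
    refine hmax.2.1 (eq_top_iff.2 fun a _ => ?_)
    obtain ⟨a', ha', hax⟩ := hex (e a 1)
    have : a' ∈ LinearMap.ker ev := heq ▸ (htr a').2 (hax x hx)
    rw [LinearMap.mem_ker, hev] at this ⊢
    rw [← ha', this]

/-- Every maximal ideal not containing all products is a invTranslate of a given one. -/
lemma exists_eq_invTranslate [Finite G] {OA : OperadAlgebraOn F O A}
    {ρ : G →* (A ≃ₗ[F] A)} (hρ : ∀ g, ρ g ∈ AlgAutGroup OA)
    (hsimple : ∀ I : Submodule F A, IsIdealPred OA I →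
      (∀ g, ∀ x ∈ I, ρ g x ∈ I) → I = ⊥ ∨ I = ⊤)
    {M N : Submodule F A} (hM : IsMaxIdeal OA M) (hN : IsMaxIdeal OA N)
    (hP : ¬ OA.products ≤ N) : ∃ s, N = invTranslate ρ M s := by
  classical
  have := Fintype.ofFinite G
  have hmax := isMaxIdeal_invTranslate hρ hM
  by_contra! hne
  have hsup := OA.sup_finset_inf_eq_top hN.1 (OA.sup_products_eq_top hN hP)
    (s := Finset.univ.image (invTranslate ρ M))
    (by
      intro K hK
      obtain ⟨x, -, rfl⟩ := Finset.mem_image.1 hK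
      exact (hmax x).1)
    (by
      intro K hK
      obtain ⟨x, -, rfl⟩ := Finset.mem_image.1 hK
      refine hN.2.2 _ (OA.isIdealPred_sup hN.1 (hmax x).1) (left_lt_sup.2 fun hle => ?_)
      exact hN.2.1 ((hmax x).2.2 N hN.1 (lt_of_le_of_ne hle (hne x).symm)))
  have hbot : (Finset.univ.image (invTranslate ρ M)).inf id = ⊥ := by
    rw [Finset.inf_image, Finset.inf_univ_eq_iInf]
    exact iInf_invTranslate_eq_bot hρ hsimple hM
  rw [hbot, sup_bot_eq] at hsup
  exact hN.2.1 hsup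

end Equivariant

/-- every simple `G`-equivariant `C`-algebra is isomorphic, as a
`G`-equivariant `C`-algebra, to `Fun_H(G,B)` for some `H ≤ G`, simple `C`-algebra `B`
and homomorphism `φ : H → Aut(B)`; moreover `H` is unique up to conjugation in `G`. -/
theorem equivariant_simple_classification {F : Type} [Field F] {O : LinearOperadData F}
    {A : Type} [AddCommGroup A] [Module F A] [FiniteDimensional F A]
    (OA : OperadAlgebraOn F O A)
    (G : Type) [Group G] [Finite G]
    (ρ : G →* (A ≃ₗ[F] A)) (hρ : ∀ g, ρ g ∈ AlgAutGroup OA)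
    (hsimple : ∀ I : Submodule F A, IsIdealPred OA I →
      (∀ g, ∀ x ∈ I, ρ g x ∈ I) → I = ⊥ ∨ I = ⊤)
    (hE : EA OA ≠ ⊥) :
    ∃ (H : Subgroup G) (Bb : OperadAlgBundle F O) (φ : H →* AlgAutGroup Bb.alg),
      IsFunHModel OA ρ H Bb φ ∧
      ∀ (H' : Subgroup G) (Bb' : OperadAlgBundle F O) (φ' : H' →* AlgAutGroup Bb'.alg),
        IsFunHModel OA ρ H' Bb' φ' → ∃ s : G, ∀ x, x ∈ H' ↔ s * x * s⁻¹ ∈ H := by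
  have : Nontrivial A := by
    by_contra h
    rw [not_nontrivial_iff_subsingleton] at h
    exact hE (OA.EA_eq_bot_iff.2 fun _ _ _ _ => Subsingleton.elim _ _)
  obtain ⟨M, hM⟩ := OA.exists_isMaxIdeal
  refine ⟨_, _, _, isFunHModel_translateStabilizer hρ hsimple hE hM, fun H' Bb' φ' hmodel => ?_⟩
  obtain ⟨N, hN, hP, rfl⟩ := hmodel.exists_isMaxIdeal
  obtain ⟨s, rfl⟩ := exists_eq_invTranslate hρ hsimple hM hN hP
  refine ⟨s, fun x => ?_⟩
  rw [mem_translateStabilizer, ← invTranslate_mul, invTranslate_eq_invTranslate_iff]
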